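/- Let ξ ∈ (0,1), L > 0, V a Banach space, and let ω and ω̄ be controls on Δ_T. Let h : Δ_T → V be a continuous two-index function which has finite localized ξ-variation with respect to (ω̄,L) and satisfies ‖δh_{s,u,t}‖ ≤ ω(s,t)^{1/ξ} for all 0 ≤ s ≤ u ≤ t ≤ T with ω̄(s,t) ≤ L, where δh_{s,u,t} := h(s,t) − h(s,u) − h(u,t). Then there exists a constant C_ξ > 0 depending only on ξ such that ‖h(s,t)‖ ≤ C_ξ ω(s,t)^{1/ξ} for all (s,t) ∈ Δ_T with ω̄(s,t) ≤ L. -/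

import Mathlib

open Set

/-- The simplex `Δ_T = {(s,t) : 0 ≤ s ≤ t ≤ T}`. -/
def Simplex (T : ℝ) : Set (ℝ × ℝ) := {q | 0 ≤ q.1 ∧ q.1 ≤ q.2 ∧ q.2 ≤ T}

/-- A control on `Δ_T`: a continuous nonnegative function vanishing on the diagonal
and superadditive. -/
structure IsControl (T : ℝ) (ω : ℝ → ℝ → ℝ) : Prop where
  nonneg : ∀ ⦃s t : ℝ⦄, 0 ≤ s → s ≤ t → t ≤ T → 0 ≤ ω s t
  cont : ContinuousOn (fun q : ℝ × ℝ => ω q.1 q.2) (Simplex T)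
  diag : ∀ ⦃s : ℝ⦄, 0 ≤ s → s ≤ T → ω s s = 0
  superadd : ∀ ⦃s u t : ℝ⦄, 0 ≤ s → s ≤ u → u ≤ t → t ≤ T → ω s u + ω u t ≤ ω s t

/-- A control is strictly positive if it vanishes only on the diagonal. -/
def StrictlyPositive (T : ℝ) (ω : ℝ → ℝ → ℝ) : Prop :=
  ∀ ⦃s t : ℝ⦄, 0 ≤ s → s ≤ t → t ≤ T → ω s t = 0 → s = t

/-- `τ 0 = s < τ 1 < ⋯ < τ N = t` is a partition of `[s,t]`. -/
def IsPartition (s t : ℝ) (N : ℕ) (τ : ℕ → ℝ) : Prop :=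
  τ 0 = s ∧ τ N = t ∧ ∀ i < N, τ i < τ (i + 1)

/-- A partition is `(ω̄,L)`-admissible if `ω̄(τ i, τ (i+1)) ≤ L` for every step. -/
def IsAdmissible (ωb : ℝ → ℝ → ℝ) (L : ℝ) (N : ℕ) (τ : ℕ → ℝ) : Prop :=
  ∀ i < N, ωb (τ i) (τ (i + 1)) ≤ L

/-- The `p`-sum of the two-index function `g` along a partition. -/
noncomputable def pSum {V : Type*} [NormedAddCommGroup V]
    (g : ℝ → ℝ → V) (p : ℝ) (N : ℕ) (τ : ℕ → ℝ) : ℝ :=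
  ∑ i ∈ Finset.range N, ‖g (τ i) (τ (i + 1))‖ ^ p

/-- Increments of a one-index function, viewed as a two-index function. -/
def inc {V : Type*} [NormedAddCommGroup V] (f : ℝ → V) : ℝ → ℝ → V :=
  fun a b => f b - f a

/-- The set of `p`-sums of `g` along `(ω̄,L)`-admissible partitions of `[s,t]`. -/
def locVarSet {V : Type*} [NormedAddCommGroup V] (g : ℝ → ℝ → V) (p : ℝ)
    (ωb : ℝ → ℝ → ℝ) (L s t : ℝ) : Set ℝ :=
  {x | ∃ N τ, IsPartition s t N τ ∧ IsAdmissible ωb L N τ ∧ x = pSum g p N τ}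

/-- The localized `p`-variation `‖g‖_{p,(ω̄,L),[s,t]}^p` (raised to the `p`-th power). -/
noncomputable def locVar {V : Type*} [NormedAddCommGroup V] (g : ℝ → ℝ → V) (p : ℝ)
    (ωb : ℝ → ℝ → ℝ) (L s t : ℝ) : ℝ :=
  sSup (locVarSet g p ωb L s t)

/-- The set of `p`-sums of `g` along arbitrary partitions of `[s,t]`. -/
def varSet {V : Type*} [NormedAddCommGroup V] (g : ℝ → ℝ → V) (p : ℝ) (s t : ℝ) : Set ℝ :=
  {x | ∃ N τ, IsPartition s t N τ ∧ x = pSum g p N τ}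

/-- The (unlocalized) `p`-variation `‖g‖_{p,[s,t]}^p` (raised to the `p`-th power). -/
noncomputable def pVar {V : Type*} [NormedAddCommGroup V] (g : ℝ → ℝ → V) (p : ℝ)
    (s t : ℝ) : ℝ :=
  sSup (varSet g p s t)

theorem isCompact_simplex (T : ℝ) : IsCompact (Simplex T) := by
  refine (isCompact_Icc (a := ((0 : ℝ), (0 : ℝ))) (b := (T, T))).of_isClosed_subset ?_ ?_
  · exact (isClosed_le continuous_const continuous_fst).inter
      ((isClosed_le continuous_fst continuous_snd).inter
        (isClosed_le continuous_snd continuous_const))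
  · rintro ⟨a, b⟩ ⟨h1, h2, h3⟩
    simp only at h1 h2 h3
    exact ⟨⟨h1, h1.trans h2⟩, ⟨h2.trans h3, h3⟩⟩

/-- A continuous two-index function vanishing on the diagonal is uniformly small near it. -/
theorem exists_norm_le_of_sub_lt {V : Type*} [NormedAddCommGroup V] {T : ℝ} {h : ℝ → ℝ → V}
    (hc : ContinuousOn (fun q : ℝ × ℝ => h q.1 q.2) (Simplex T))
    (hd : ∀ u, 0 ≤ u → u ≤ T → h u u = 0) {ε : ℝ} (hε : 0 < ε) :
    ∃ δ > 0, ∀ u v, 0 ≤ u → u ≤ v → v ≤ T → v - u < δ → ‖h u v‖ ≤ ε := by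
  have huc := (isCompact_simplex T).uniformContinuousOn_of_continuous hc
  obtain ⟨δ, hδ, H⟩ := Metric.uniformContinuousOn_iff.1 huc ε hε
  refine ⟨δ, hδ, fun u v hu huv hv hlt => ?_⟩
  have := H (u, v) ⟨hu, huv, hv⟩ (u, u) ⟨hu, le_rfl, huv.trans hv⟩ (by
    rw [Prod.dist_eq]
    simp only [dist_self, Real.dist_eq, abs_of_nonneg (sub_nonneg.2 huv)]
    exact max_lt hδ hlt)
  simp only [hd u hu (huv.trans hv), dist_zero_right] at this
  exact this.le

theorem IsControl.mono {T : ℝ} {ω : ℝ → ℝ → ℝ} (hω : IsControl T ω) {s s' t' t : ℝ}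
    (h0 : 0 ≤ s) (h1 : s ≤ s') (h2 : s' ≤ t') (h3 : t' ≤ t) (h4 : t ≤ T) :
    ω s' t' ≤ ω s t := by
  have a := hω.superadd h0 h1 (h2.trans h3) h4
  have b := hω.superadd (h0.trans h1) h2 h3 h4
  have c := hω.nonneg h0 h1 ((h2.trans h3).trans h4)
  have d := hω.nonneg (h0.trans (h1.trans h2)) h3 h4
  linarith

theorem IsPartition.mono {s t : ℝ} {N : ℕ} {τ : ℕ → ℝ} (hτ : IsPartition s t N τ) {i j : ℕ}
    (hij : i ≤ j) (hj : j ≤ N) : τ i ≤ τ j := by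
  induction j, hij using Nat.le_induction with
  | base => exact le_rfl
  | succ k _ ih => exact (ih (by lia)).trans (hτ.2.2 k (by lia)).le

theorem IsPartition.left_le {s t : ℝ} {N : ℕ} {τ : ℕ → ℝ} (hτ : IsPartition s t N τ) {i : ℕ}
    (hi : i ≤ N) : s ≤ τ i :=
  hτ.1 ▸ hτ.mono (Nat.zero_le i) hi

theorem IsPartition.le_right {s t : ℝ} {N : ℕ} {τ : ℕ → ℝ} (hτ : IsPartition s t N τ) {i : ℕ}
    (hi : i ≤ N) : τ i ≤ t :=
  hτ.2.1 ▸ hτ.mono hi le_rfl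

theorem exists_isPartition_sub_lt {s t δ : ℝ} (hst : s ≤ t) (hδ : 0 < δ) :
    ∃ N τ, IsPartition s t N τ ∧ ∀ i < N, τ (i + 1) - τ i < δ := by
  rcases hst.eq_or_lt with rfl | hlt
  · exact ⟨0, fun _ => s, ⟨rfl, rfl, by simp⟩, by simp⟩
  obtain ⟨n, hn⟩ := exists_nat_gt ((t - s) / δ)
  have hpos : 0 < t - s := sub_pos.2 hlt
  have hn0 : (0 : ℝ) < n := (div_pos hpos hδ).trans hn
  have hstep : ∀ i : ℕ, s + ((i + 1 : ℕ) : ℝ) * ((t - s) / n) - (s + i * ((t - s) / n))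
      = (t - s) / n := fun i => by push_cast; ring
  refine ⟨n, fun i => s + i * ((t - s) / n), ⟨by simp, ?_, fun i _ => ?_⟩, fun i _ => ?_⟩
  · field_simp
    ring
  · exact sub_pos.1 ((hstep i).symm ▸ div_pos hpos hn0)
  · rw [hstep, div_lt_iff₀ hn0]
    rw [div_lt_iff₀ hδ] at hn
    linarith

theorem add_mem_locVarSet {V : Type*} [NormedAddCommGroup V] {g : ℝ → ℝ → V} {p : ℝ}
    {ωb : ℝ → ℝ → ℝ} {L s u t x y : ℝ} (hx : x ∈ locVarSet g p ωb L s u)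
    (hy : y ∈ locVarSet g p ωb L u t) : x + y ∈ locVarSet g p ωb L s t := by
  obtain ⟨N, τ, ⟨h0, hN, hlt⟩, had, rfl⟩ := hx
  obtain ⟨M, σ, ⟨k0, kM, klt⟩, kad, rfl⟩ := hy
  set ρ : ℕ → ℝ := fun i => if i ≤ N then τ i else σ (i - N) with hρ
  have hleft : ∀ i ≤ N, ρ i = τ i := fun i hi => by simp [hρ, hi]
  have hright : ∀ i, ρ (N + i) = σ i := fun i => by
    rcases Nat.eq_zero_or_pos i with rfl | hi
    · rw [add_zero, hleft N le_rfl, hN, k0]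
    · simp [hρ, hi.ne']
  have key : ∀ P : ℝ → ℝ → Prop, (∀ i < N, P (τ i) (τ (i + 1))) →
      (∀ i < M, P (σ i) (σ (i + 1))) → ∀ i < N + M, P (ρ i) (ρ (i + 1)) := by
    intro P h1 h2 i hi
    rcases lt_or_ge i N with h | h
    · rw [hleft i h.le, hleft (i + 1) h]
      exact h1 i h
    · obtain ⟨j, rfl⟩ := Nat.exists_eq_add_of_le h
      rw [add_assoc, hright, hright]
      exact h2 j (by lia)
  refine ⟨N + M, ρ, ⟨by rw [hleft 0 (Nat.zero_le _), h0], by rw [hright, kM],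
    key (· < ·) hlt klt⟩, key (fun a b => ωb a b ≤ L) had kad, ?_⟩
  unfold pSum
  rw [Finset.sum_range_add]
  congr 1
  · refine Finset.sum_congr rfl fun i hi => ?_
    have hi := Finset.mem_range.1 hi
    rw [hleft i hi.le, hleft (i + 1) hi]
  · refine Finset.sum_congr rfl fun i _ => ?_
    rw [add_assoc, hright, hright]

theorem nonneg_of_mem_locVarSet {V : Type*} [NormedAddCommGroup V] {g : ℝ → ℝ → V} {p : ℝ}
    {ωb : ℝ → ℝ → ℝ} {L s t x : ℝ} (hx : x ∈ locVarSet g p ωb L s t) : 0 ≤ x := by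
  obtain ⟨N, τ, _, _, rfl⟩ := hx
  exact Finset.sum_nonneg fun i _ => Real.rpow_nonneg (norm_nonneg _) _

theorem IsControl.locVarSet_nonempty {V : Type*} [NormedAddCommGroup V] {T : ℝ}
    {ωb : ℝ → ℝ → ℝ} (hωb : IsControl T ωb) (g : ℝ → ℝ → V) (p : ℝ) {L s t : ℝ} (hL : 0 < L)
    (hs : 0 ≤ s) (hst : s ≤ t) (ht : t ≤ T) : (locVarSet g p ωb L s t).Nonempty := by
  obtain ⟨δ, hδ, H⟩ := exists_norm_le_of_sub_lt hωb.cont (fun u hu hT => hωb.diag hu hT) hL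
  obtain ⟨N, τ, hτ, hm⟩ := exists_isPartition_sub_lt hst hδ
  exact ⟨_, N, τ, hτ, fun i hi => (Real.le_norm_self _).trans
    (H _ _ (hs.trans (hτ.left_le hi.le)) (hτ.2.2 i hi).le ((hτ.le_right hi).trans ht)
      (hm i hi)), rfl⟩

/-- The bound on the localized variation over `[0,T]` also holds over every subinterval. -/
theorem IsControl.le_of_mem_locVarSet {V : Type*} [NormedAddCommGroup V] {T : ℝ}
    {ωb : ℝ → ℝ → ℝ} (hωb : IsControl T ωb) {g : ℝ → ℝ → V} {p L s t M x : ℝ} (hL : 0 < L)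
    (hs : 0 ≤ s) (hst : s ≤ t) (ht : t ≤ T) (hM : M ∈ upperBounds (locVarSet g p ωb L 0 T))
    (hx : x ∈ locVarSet g p ωb L s t) : x ≤ M := by
  obtain ⟨y, hy⟩ := hωb.locVarSet_nonempty g p hL le_rfl hs (hst.trans ht)
  obtain ⟨z, hz⟩ := hωb.locVarSet_nonempty g p hL (hs.trans hst) ht le_rfl
  have := hM (add_mem_locVarSet (add_mem_locVarSet hy hx) hz)
  have := nonneg_of_mem_locVarSet hy
  have := nonneg_of_mem_locVarSet hz
  linarith

/-- The sewing estimate: an almost additive two-index function differs from its Riemann sum along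
a partition by at most a constant times `ω ^ θ`. -/
theorem norm_sub_sum_le {V : Type*} [NormedAddCommGroup V] {T : ℝ} {ω : ℝ → ℝ → ℝ}
    (hω : IsControl T ω) {h : ℝ → ℝ → V} {s t θ C : ℝ} (hs : 0 ≤ s) (ht : t ≤ T) (hθ : 0 ≤ θ)
    (hC0 : 0 ≤ C) (hC : 2 + 2 * (C * (1 / 2) ^ θ) ≤ C)
    (hd : ∀ u, s ≤ u → u ≤ t → h u u = 0)
    (hδ : ∀ a u b, s ≤ a → a ≤ u → u ≤ b → b ≤ t → ‖h a b - h a u - h u b‖ ≤ ω a b ^ θ)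
    {N : ℕ} {τ : ℕ → ℝ} (hτ : IsPartition s t N τ) (n a b : ℕ) (hn : a + n = b) (hb : b ≤ N) :
    ‖h (τ a) (τ b) - ∑ i ∈ Finset.Ico a b, h (τ i) (τ (i + 1))‖ ≤ C * ω (τ a) (τ b) ^ θ := by
  induction n using Nat.strong_induction_on generalizing a b with
  | _ n ih =>
  have hnn : ∀ i j, i ≤ j → j ≤ N → 0 ≤ ω (τ i) (τ j) := fun i j hij hj =>
    hω.nonneg (hs.trans (hτ.left_le (hij.trans hj))) (hτ.mono hij hj) ((hτ.le_right hj).trans ht)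
  have hW := hnn a b (by lia) hb
  rcases Nat.eq_zero_or_pos n with rfl | hpos
  · obtain rfl : a = b := by simpa using hn
    rw [hd _ (hτ.left_le hb) (hτ.le_right hb)]
    simp only [Finset.Ico_self, Finset.sum_empty, sub_zero, norm_zero]
    positivity
  have hdiag : ∀ i ≤ N, ω (τ i) (τ i) = 0 := fun i hi =>
    hω.diag (hs.trans (hτ.left_le hi)) ((hτ.le_right hi).trans ht)
  set W := ω (τ a) (τ b) with hWdef
  obtain ⟨j, haj, hjb, hj1, hj2⟩ : ∃ j, a ≤ j ∧ j < b ∧ ω (τ a) (τ j) ≤ W / 2 ∧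
      ω (τ (j + 1)) (τ b) ≤ W / 2 := by
    have hex : ∃ k, a ≤ k ∧ k < b ∧ ω (τ (k + 1)) (τ b) ≤ W / 2 := by
      refine ⟨b - 1, by lia, by lia, ?_⟩
      rw [Nat.sub_add_cancel (by lia), hdiag b hb]
      linarith
    classical
    obtain ⟨h1, h2, h3⟩ := Nat.find_spec hex
    refine ⟨Nat.find hex, h1, h2, ?_, h3⟩
    rcases h1.eq_or_lt with h4 | h4
    · rw [← h4, hdiag a (by lia)]
      linarith
    · have hmin := Nat.find_min hex (m := Nat.find hex - 1) (by lia)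
      rw [Nat.sub_add_cancel (by lia)] at hmin
      have hgt : W / 2 < ω (τ (Nat.find hex)) (τ b) := by
        by_contra! hle
        exact hmin ⟨by lia, by lia, hle⟩
      have := hω.superadd (hs.trans (hτ.left_le (by lia))) (hτ.mono h1 (by lia))
        (hτ.mono h2.le hb) ((hτ.le_right hb).trans ht)
      linarith
  have e1 := ih (j - a) (by lia) a j (by lia) (by lia)
  have e2 := ih (b - (j + 1)) (by lia) (j + 1) b (by lia) hb
  have e3 := hδ (τ a) (τ j) (τ b) (hτ.left_le (by lia)) (hτ.mono haj (by lia))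
    (hτ.mono hjb.le hb) (hτ.le_right hb)
  have e4 := hδ (τ j) (τ (j + 1)) (τ b) (hτ.left_le (by lia)) (hτ.mono (by lia) (by lia))
    (hτ.mono hjb hb) (hτ.le_right hb)
  have half : ∀ x, 0 ≤ x → x ≤ W / 2 → C * x ^ θ ≤ C * (1 / 2) ^ θ * W ^ θ := by
    intro x hx hxW
    rw [mul_assoc, ← Real.mul_rpow (by norm_num) hW]
    gcongr
    linarith
  have f1 := half _ (hnn a j haj (by lia)) hj1
  have f2 := half _ (hnn (j + 1) b hjb hb) hj2
  have f4 : ω (τ j) (τ b) ^ θ ≤ W ^ θ := Real.rpow_le_rpow (hnn j b hjb.le hb)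
    (hω.mono (hs.trans (hτ.left_le (by lia))) (hτ.mono haj (by lia)) (hτ.mono hjb.le hb) le_rfl
      ((hτ.le_right hb).trans ht)) hθ
  have hsum : h (τ a) (τ b) - ∑ i ∈ Finset.Ico a b, h (τ i) (τ (i + 1)) =
      (h (τ a) (τ b) - h (τ a) (τ j) - h (τ j) (τ b)) +
      (h (τ j) (τ b) - h (τ j) (τ (j + 1)) - h (τ (j + 1)) (τ b)) +
      (h (τ a) (τ j) - ∑ i ∈ Finset.Ico a j, h (τ i) (τ (i + 1))) +
      (h (τ (j + 1)) (τ b) - ∑ i ∈ Finset.Ico (j + 1) b, h (τ i) (τ (i + 1))) := by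
    rw [← Finset.sum_Ico_consecutive _ haj hjb.le, Finset.sum_eq_sum_Ico_succ_bot hjb]
    abel
  have hWθ : 0 ≤ W ^ θ := Real.rpow_nonneg hW θ
  have hfin := mul_le_mul_of_nonneg_right hC hWθ
  rw [hsum]
  refine norm_add₄_le.trans ?_
  linarith

/-- If, in addition to the hypotheses of the localized Sewing Lemma, the
two-index function `h` itself has finite localized `ξ`-variation with respect to `(ω̄,L)`,
then `‖h(s,t)‖ ≤ C_ξ ω(s,t)^(1/ξ)` whenever `ω̄(s,t) ≤ L`, with `C_ξ` depending only on `ξ`. -/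
theorem statement7 (ξ : ℝ) (hξ : ξ ∈ Set.Ioo (0 : ℝ) 1) :
    ∃ C : ℝ, 0 < C ∧
      ∀ (V : Type*) [NormedAddCommGroup V] [NormedSpace ℝ V] [CompleteSpace V],
        ∀ T : ℝ, 0 < T → ∀ L : ℝ, 0 < L →
          ∀ ω ωb : ℝ → ℝ → ℝ, IsControl T ω → IsControl T ωb →
            ∀ h : ℝ → ℝ → V,
              ContinuousOn (fun q : ℝ × ℝ => h q.1 q.2) (Simplex T) →
              BddAbove (locVarSet h ξ ωb L 0 T) →
              (∀ s u t : ℝ, 0 ≤ s → s ≤ u → u ≤ t → t ≤ T → ωb s t ≤ L →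
                ‖h s t - h s u - h u t‖ ≤ ω s t ^ (1 / ξ)) →
              ∀ s t : ℝ, (s, t) ∈ Simplex T → ωb s t ≤ L →
                ‖h s t‖ ≤ C * ω s t ^ (1 / ξ) := by
  obtain ⟨h0, h1⟩ := hξ
  have hθ : 1 < 1 / ξ := by rw [lt_div_iff₀ h0]; linarith
  set θ := 1 / ξ
  have hq : (1 / 2 : ℝ) ^ θ < 1 / 2 := by
    simpa using Real.rpow_lt_rpow_of_exponent_gt (x := (1 / 2 : ℝ)) (by norm_num) (by norm_num) hθ
  have hden : 0 < 1 - 2 * (1 / 2 : ℝ) ^ θ := by linarith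
  set C := 2 / (1 - 2 * (1 / 2 : ℝ) ^ θ) with hCdef
  have hC0 : 0 < C := by positivity
  have hC : 2 + 2 * (C * (1 / 2 : ℝ) ^ θ) ≤ C := by
    have : C * (1 - 2 * (1 / 2 : ℝ) ^ θ) = 2 := div_mul_cancel₀ _ hden.ne'
    linarith
  refine ⟨C, hC0, ?_⟩
  intro V _ _ _ T _ L hL ω ωb hω hωb h hc hbdd hδ s t hst hstL
  obtain ⟨hs, hle, ht⟩ : 0 ≤ s ∧ s ≤ t ∧ t ≤ T := hst
  obtain ⟨M, hM⟩ := hbdd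
  have hd : ∀ u, 0 ≤ u → u ≤ T → h u u = 0 := by
    intro u hu huT
    have := hδ u u u hu le_rfl le_rfl huT (by rw [hωb.diag hu huT]; exact hL.le)
    rw [hω.diag hu huT, Real.zero_rpow (by linarith)] at this
    simpa using this
  have hM0 : 0 ≤ M := by
    obtain ⟨x, hx⟩ := hωb.locVarSet_nonempty h ξ hL hs hle ht
    exact (nonneg_of_mem_locVarSet hx).trans (hωb.le_of_mem_locVarSet hL hs hle ht hM hx)
  have hbL : ∀ a b, s ≤ a → a ≤ b → b ≤ t → ωb a b ≤ L := fun a b ha hab hb =>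
    (hωb.mono hs ha hab hb ht).trans hstL
  have key : ∀ η > 0, ‖h s t‖ ≤ C * ω s t ^ θ + η * M := by
    intro η hη
    have hξ1 : 0 < 1 - ξ := sub_pos.2 h1
    obtain ⟨δ, hδ0, H⟩ := exists_norm_le_of_sub_lt hc hd (Real.rpow_pos_of_pos hη (1 - ξ)⁻¹)
    obtain ⟨N, τ, hτ, hm⟩ := exists_isPartition_sub_lt hle hδ0
    have hsew := norm_sub_sum_le hω hs ht (by linarith) hC0.le hC
      (fun u hu hut => hd u (hs.trans hu) (hut.trans ht))
      (fun a u b ha hau hub hbt => hδ a u b (hs.trans ha) hau hub (hbt.trans ht)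
        (hbL a b ha (hau.trans hub) hbt)) hτ N 0 N (zero_add N) le_rfl
    rw [hτ.1, hτ.2.1, Nat.Ico_zero_eq_range] at hsew
    have hvar : pSum h ξ N τ ≤ M := hωb.le_of_mem_locVarSet hL hs hle ht hM
      ⟨N, τ, hτ, fun i hi => hbL _ _ (hτ.left_le hi.le) (hτ.2.2 i hi).le (hτ.le_right hi), rfl⟩
    have hsum : ‖∑ i ∈ Finset.range N, h (τ i) (τ (i + 1))‖ ≤ η * pSum h ξ N τ := by
      rw [pSum, Finset.mul_sum]
      refine norm_sum_le_of_le _ fun i hi => ?_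
      have hi := Finset.mem_range.1 hi
      have hsmall := H (τ i) (τ (i + 1)) (hs.trans (hτ.left_le hi.le)) (hτ.2.2 i hi).le
        ((hτ.le_right hi).trans ht) (hm i hi)
      set x := ‖h (τ i) (τ (i + 1))‖
      have hx : 0 ≤ x := norm_nonneg _
      have hpow : x ^ (1 - ξ) ≤ η := by
        rwa [Real.le_rpow_inv_iff_of_pos hx hη.le hξ1] at hsmall
      calc x = x ^ (1 - ξ) * x ^ ξ := by
            rw [← Real.rpow_add' hx (by norm_num), sub_add_cancel, Real.rpow_one]
        _ ≤ η * x ^ ξ := by gcongr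
    have := norm_sub_norm_le (h s t) (∑ i ∈ Finset.range N, h (τ i) (τ (i + 1)))
    have := mul_le_mul_of_nonneg_left hvar hη.le
    linarith
  refine le_of_forall_pos_le_add fun ε hε => (key (ε / (M + 1)) (by positivity)).trans ?_
  gcongr
  rw [div_mul_eq_mul_div, div_le_iff₀ (by linarith)]
  nlinarith
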